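/- There exists a constant C > 1 such that the following holds for every q ∈ (0,1). Let (W_i)_{i≥0} be the Markov chain on 𝒱 with transition matrix Q_bal (parameter q). Then for every state V ∈ 𝒱 and every state V′ of the form A_b^(k) or B_b^(kℓ), one has Q_bal^6(V, V′) ≥ π_bal(V′)/C; and for every state V ∈ 𝒱 and every state V′ of the form A_f^(k) or B_f^(kℓ), one has P_V( W_i = V′ for some i ∈ {0,1,…,6} ) ≥ π_bal(V′)/C, where P_V denotes probability for the chain started at W_0 = V. -/

import Mathlib

/-- Edge type of a state: backward (`b`) or forward (`f`). -/
inductive Edge : Type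
  | b | f
deriving DecidableEq

instance : Fintype Edge where
  elems := {Edge.b, Edge.f}
  complete := fun x => by cases x <;> simp

/-- The 18-element state space `𝒱`: states `A_e^(k)` are encoded as
`Sum.inl (e, k)` and states `B_e^(kℓ)` (with `k ≠ ℓ`) as `Sum.inr (e, ⟨(k, ℓ), _⟩)`. -/
abbrev St : Type := (Edge × Fin 3) ⊕ (Edge × {kl : Fin 3 × Fin 3 // kl.1 ≠ kl.2})

/-- The element of `{0,1,2}` different from both `k` and `l` (when `k ≠ l`). -/
def third (k l : Fin 3) : Fin 3 :=
  ⟨(6 - (k : ℕ) - (l : ℕ)) % 3, Nat.mod_lt _ (by norm_num)⟩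

/-- The transition matrix `Q` with parameters `q₁ = qv 0`, `q₂ = qv 1`, `q₃ = qv 2`
(and `q = qv 0 + qv 1 + qv 2`); all entries not prescribed by the rules are `0`. -/
noncomputable def Qmat (qv : Fin 3 → ℝ) : Matrix St St ℝ :=
  Matrix.of fun s t =>
    match s, t with
    | Sum.inl (_, k), Sum.inl (Edge.b, j) => if j = k then 0 else qv (third k j)
    | Sum.inl (_, _), Sum.inl (Edge.f, _) => 0
    | Sum.inl (_, k), Sum.inr (Edge.f, kl) =>
        if kl.1.1 = k then (1 - (qv 0 + qv 1 + qv 2)) / 2 else 0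
    | Sum.inl (_, k), Sum.inr (Edge.b, kl) => if kl.1.1 = k then qv k / 2 else 0
    | Sum.inr (_, kl), Sum.inl (Edge.b, j) =>
        if j = kl.1.1 then qv (third kl.1.1 kl.1.2) else 0
    | Sum.inr (_, kl), Sum.inl (Edge.f, j) =>
        if j = third kl.1.1 kl.1.2 then 1 - (qv 0 + qv 1 + qv 2) else 0
    | Sum.inr (_, kl), Sum.inr (Edge.b, kl') =>
        if kl'.1.1 = kl.1.1 ∧ kl'.1.2 = third kl.1.1 kl.1.2 then qv kl.1.1
        else if kl'.1.1 = kl.1.2 ∧ kl'.1.2 = third kl.1.1 kl.1.2 then qv kl.1.2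
        else 0
    | Sum.inr _, Sum.inr (Edge.f, _) => 0

/-- The balanced transition matrix `Q_bal`, i.e. `Q` with `q₁ = q₂ = q₃ = q/3`. -/
noncomputable def Qbal (q : ℝ) : Matrix St St ℝ := Qmat fun _ => q / 3

/-- The distribution `π_bal` on `𝒱`. -/
noncomputable def piBal (q : ℝ) : St → ℝ
  | Sum.inl (Edge.b, _) => q / 6
  | Sum.inl (Edge.f, _) => (1 - q) / 6
  | Sum.inr (Edge.b, _) => q / 12
  | Sum.inr (Edge.f, _) => (1 - q) / 12

/-- `V` is a state with a backward edge (of the form `A_b^(k)` or `B_b^(kℓ)`). -/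
def isBack : St → Prop
  | Sum.inl (e, _) => e = Edge.b
  | Sum.inr (e, _) => e = Edge.b

/-- `hitProb Q V' t V` is the probability that a Markov chain with transition matrix
`Q` started at `W_0 = V` satisfies `W_i = V'` for some `i ∈ {0,1,…,t}`. -/
noncomputable def hitProb (Q : Matrix St St ℝ) (V' : St) : ℕ → St → ℝ
  | 0, V => if V = V' then 1 else 0
  | t + 1, V => if V = V' then 1 else ∑ y : St, Q V y * hitProb Q V' t y

/-- The edge type of a state. -/
def edgeOf : St → Edge
  | Sum.inl (e, _) => e
  | Sum.inr (e, _) => e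

/-- The transitions that have positive probability for every `q ∈ (0,1)`. -/
def Step : St → St → Prop
  | Sum.inl (_, k), Sum.inl (e, j) => e = Edge.b ∧ j ≠ k
  | Sum.inl (_, k), Sum.inr (_, kl) => kl.1.1 = k
  | Sum.inr (_, kl), Sum.inl (Edge.b, j) => j = kl.1.1
  | Sum.inr (_, kl), Sum.inl (Edge.f, j) => j = third kl.1.1 kl.1.2
  | Sum.inr (_, kl), Sum.inr (e, kl') =>
      e = Edge.b ∧ kl'.1.2 = third kl.1.1 kl.1.2 ∧ (kl'.1.1 = kl.1.1 ∨ kl'.1.1 = kl.1.2)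

instance : DecidableRel Step
  | Sum.inl (_, _), Sum.inl (_, _) => inferInstanceAs (Decidable (_ ∧ _))
  | Sum.inl (_, _), Sum.inr (_, _) => inferInstanceAs (Decidable (_ = _))
  | Sum.inr (_, _), Sum.inl (Edge.b, _) => inferInstanceAs (Decidable (_ = _))
  | Sum.inr (_, _), Sum.inl (Edge.f, _) => inferInstanceAs (Decidable (_ = _))
  | Sum.inr (_, _), Sum.inr (_, _) => inferInstanceAs (Decidable (_ ∧ _ ∧ _))

/-- The set `S` can be reached in exactly `n` steps, all of them into states of edge type `e`. -/
def Reaches (e : Edge) (S : St → Prop) : ℕ → St → Prop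
  | 0, V => S V
  | n + 1, V => ∃ y, (Step V y ∧ edgeOf y = e) ∧ Reaches e S n y

instance Reaches.decidable (e : Edge) (S : St → Prop) [DecidablePred S] :
    ∀ n V, Decidable (Reaches e S n V)
  | 0, V => inferInstanceAs (Decidable (S V))
  | n + 1, V =>
    haveI := Reaches.decidable e S n
    inferInstanceAs (Decidable (∃ y, (Step V y ∧ edgeOf y = e) ∧ Reaches e S n y))

set_option synthInstance.maxSize 2000 in
theorem reaches_five (e : Edge) (V V' : St) :
    Reaches e (fun z => Step z V' ∨ edgeOf V' = Edge.f ∧ z = V') 5 V := by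
  revert e V V'
  decide +kernel

theorem reaches_five_of_edgeOf_eq_b (e : Edge) (V V' : St) (h : edgeOf V' = Edge.b) :
    Reaches e (Step · V') 5 V := by
  simpa [h] using reaches_five e V V'

/-- The total probability of moving to a state of a given edge type (the same from every state). -/
def edgeWeight (q : ℝ) : Edge → ℝ
  | Edge.b => q
  | Edge.f => 1 - q

theorem edgeWeight_nonneg {q : ℝ} (h0 : 0 ≤ q) (h1 : q ≤ 1) (e : Edge) : 0 ≤ edgeWeight q e := by
  cases e <;> simp [edgeWeight, h0, h1]

theorem edgeWeight_le_one {q : ℝ} (h0 : 0 ≤ q) (h1 : q ≤ 1) (e : Edge) : edgeWeight q e ≤ 1 := by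
  cases e <;> simp [edgeWeight, h0, h1]

theorem exists_half_le_edgeWeight (q : ℝ) : ∃ e, 1 / 2 ≤ edgeWeight q e := by
  rcases le_total (1 / 2) q with h | h
  · exact ⟨Edge.b, h⟩
  · exact ⟨Edge.f, by simp only [edgeWeight]; linarith⟩

theorem isBack_iff (V : St) : isBack V ↔ edgeOf V = Edge.b := by
  rcases V with ⟨e, k⟩ | ⟨e, k⟩ <;> rfl

theorem piBal_le {q : ℝ} (h0 : 0 ≤ q) (h1 : q ≤ 1) (V : St) :
    piBal q V ≤ edgeWeight q (edgeOf V) / 6 := by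
  rcases V with ⟨_ | _, k⟩ | ⟨_ | _, k⟩ <;> simp only [piBal, edgeOf, edgeWeight] <;> linarith

theorem Qbal_nonneg {q : ℝ} (h0 : 0 ≤ q) (h1 : q ≤ 1) (V V' : St) : 0 ≤ Qbal q V V' := by
  rcases V with ⟨e, k⟩ | ⟨e, k⟩ <;> rcases V' with ⟨_ | _, j⟩ | ⟨_ | _, j⟩ <;>
    simp only [Qbal, Qmat, Matrix.of_apply] <;> (try split_ifs) <;> linarith

theorem le_Qbal_of_step {q : ℝ} (h0 : 0 ≤ q) (h1 : q ≤ 1) {V V' : St} (h : Step V V') :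
    edgeWeight q (edgeOf V') / 6 ≤ Qbal q V V' := by
  rcases V with ⟨e, k⟩ | ⟨e, k⟩ <;> rcases V' with ⟨_ | _, j⟩ | ⟨_ | _, j⟩ <;>
    simp only [Step, reduceCtorEq, false_and, true_and] at h <;>
    simp only [Qbal, Qmat, Matrix.of_apply, edgeOf, edgeWeight, h, if_true, if_false] <;>
    (try split_ifs) <;> first | linarith | grind

/-- A lower bound propagates backwards along a path whose transitions have probability `≥ c`. -/
theorem Reaches.le_of_le {e : Edge} {S : St → Prop} {Q : Matrix St St ℝ} {u : ℕ → St → ℝ}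
    {c δ : ℝ} {m : ℕ} (hc0 : 0 ≤ c) (hc1 : c ≤ 1) (hδ0 : 0 ≤ δ) (hδ1 : δ ≤ 1)
    (hQ : ∀ V y, Step V y → edgeOf y = e → c ≤ Q V y) (hS : ∀ z, S z → δ ≤ u m z)
    (hu : ∀ n V y r, 0 ≤ r → r ≤ 1 → r ≤ u n y → c ≤ Q V y → c * r ≤ u (n + 1) V) {n : ℕ} :
    ∀ {V : St}, Reaches e S n V → c ^ n * δ ≤ u (n + m) V := by
  induction n with
  | zero => intro V h; simpa using hS V h
  | succ n ih =>
    rintro V ⟨y, ⟨hVy, hy⟩, h⟩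
    have := hu (n + m) V y (c ^ n * δ) (by positivity)
      (mul_le_one₀ (pow_le_one₀ hc0 hc1) hδ0 hδ1) (ih h) (hQ V y hVy hy)
    rwa [← mul_assoc, ← pow_succ', Nat.add_right_comm] at this

theorem hitProb_nonneg {Q : Matrix St St ℝ} (hQ : ∀ V y, 0 ≤ Q V y) (V' : St) (n : ℕ) (V : St) :
    0 ≤ hitProb Q V' n V := by
  induction n generalizing V with
  | zero => rw [hitProb]; split_ifs <;> norm_num
  | succ n ih =>
    rw [hitProb]
    split_ifs
    · norm_num
    · exact Finset.sum_nonneg fun y _ => mul_nonneg (hQ V y) (ih y)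

theorem mul_le_hitProb_succ {Q : Matrix St St ℝ} (hQ : ∀ V y, 0 ≤ Q V y) (V' : St) {n : ℕ}
    {V y : St} {c r : ℝ} (hc : c ≤ 1) (hr0 : 0 ≤ r) (hr1 : r ≤ 1) (hr : r ≤ hitProb Q V' n y)
    (hcQ : c ≤ Q V y) : c * r ≤ hitProb Q V' (n + 1) V := by
  rw [hitProb]
  split_ifs
  · exact mul_le_one₀ hc hr0 hr1
  · calc c * r ≤ Q V y * hitProb Q V' n y := mul_le_mul hcQ hr hr0 (hQ V y)
      _ ≤ ∑ y, Q V y * hitProb Q V' n y :=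
        Finset.single_le_sum (f := fun y => Q V y * hitProb Q V' n y)
          (fun y _ => mul_nonneg (hQ V y) (hitProb_nonneg hQ V' n y)) (Finset.mem_univ y)

theorem pow_apply_nonneg {Q : Matrix St St ℝ} (hQ : ∀ V y, 0 ≤ Q V y) (n : ℕ) (V V' : St) :
    0 ≤ (Q ^ n) V V' := by
  induction n generalizing V with
  | zero => rw [pow_zero, Matrix.one_apply]; split_ifs <;> norm_num
  | succ n ih =>
    rw [pow_succ', Matrix.mul_apply]
    exact Finset.sum_nonneg fun y _ => mul_nonneg (hQ V y) (ih y)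

theorem mul_le_pow_succ_apply {Q : Matrix St St ℝ} (hQ : ∀ V y, 0 ≤ Q V y) (V' : St) {n : ℕ}
    {V y : St} {c r : ℝ} (hr0 : 0 ≤ r) (hr : r ≤ (Q ^ n) y V') (hcQ : c ≤ Q V y) :
    c * r ≤ (Q ^ (n + 1)) V V' := by
  rw [pow_succ', Matrix.mul_apply]
  calc c * r ≤ Q V y * (Q ^ n) y V' := mul_le_mul hcQ hr hr0 (hQ V y)
    _ ≤ ∑ y, Q V y * (Q ^ n) y V' :=
      Finset.single_le_sum (f := fun y => Q V y * (Q ^ n) y V')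
        (fun y _ => mul_nonneg (hQ V y) (pow_apply_nonneg hQ n y V')) (Finset.mem_univ y)

/-- There is a constant `C > 1` such that for all `q ∈ (0,1)`: from any state `V`,
any backward state `V'` is reached in exactly `6` steps of `Q_bal` with probability
at least `π_bal(V')/C`, and any forward state `V'` is visited within the first `6`
steps with probability at least `π_bal(V')/C`. -/
theorem stmt11 :
    ∃ C : ℝ, 1 < C ∧
      ∀ q : ℝ, 0 < q → q < 1 → ∀ V V' : St,
        (isBack V' → piBal q V' / C ≤ (Qbal q ^ 6) V V') ∧
        (¬isBack V' → piBal q V' / C ≤ hitProb (Qbal q) V' 6 V) := by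
  refine ⟨12 ^ 5, by norm_num, fun q hq0 hq1 V V' => ?_⟩
  have hQ := Qbal_nonneg hq0.le hq1.le
  have hw0 := edgeWeight_nonneg hq0.le hq1.le (edgeOf V')
  have hw1 := edgeWeight_le_one hq0.le hq1.le (edgeOf V')
  have hπ : piBal q V' / 12 ^ 5 ≤ (1 / 12) ^ 5 * (edgeWeight q (edgeOf V') / 6) := by
    have := piBal_le hq0.le hq1.le V'
    linarith
  obtain ⟨e, he⟩ := exists_half_le_edgeWeight q
  have hstep : ∀ V y, Step V y → edgeOf y = e → 1 / 12 ≤ Qbal q V y := by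
    rintro V y h rfl
    linarith [le_Qbal_of_step hq0.le hq1.le h]
  refine ⟨fun hb => hπ.trans ?_, fun _ => hπ.trans ?_⟩
  · refine Reaches.le_of_le (u := fun n V => (Qbal q ^ n) V V') (m := 1) (by norm_num)
      (by norm_num) (by linarith) (by linarith) hstep (fun z hz => ?_)
      (fun n V y r hr0 _ hr hc => mul_le_pow_succ_apply hQ V' hr0 hr hc)
      (reaches_five_of_edgeOf_eq_b e V V' ((isBack_iff V').1 hb))
    simpa only [pow_one] using le_Qbal_of_step hq0.le hq1.le hz
  · refine Reaches.le_of_le (u := hitProb (Qbal q) V') (m := 1) (by norm_num)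
      (by norm_num) (by linarith) (by linarith) hstep (fun z hz => ?_)
      (fun n V y r hr0 hr1 hr hc => mul_le_hitProb_succ hQ V' (by norm_num) hr0 hr1 hr hc)
      (reaches_five e V V')
    rcases hz with hz | ⟨_, rfl⟩
    · have h1 : (1 : ℝ) ≤ hitProb (Qbal q) V' 0 V' := by simp [hitProb]
      have := mul_le_hitProb_succ hQ V' (by linarith) zero_le_one le_rfl h1
        (le_Qbal_of_step hq0.le hq1.le hz)
      rwa [mul_one] at this
    · rw [hitProb, if_pos rfl]
      linarith
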